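/- arXiv:2503.08982 — 5 statements merged into one kernel-verified Lean document; each statement's English description precedes it below -/
import Mathlib

section
/- Let S be a nonempty finite set and let b, b′ : S → ℝ be elements of the standard simplex on S with b(s) > 0 for every s ∈ S. Define λ = min_{s ∈ S} b′(s)/b(s). Then: (i) 0 ≤ λ ≤ 1; (ii) b′(s) − λ·b(s) ≥ 0 for every s; (iii) λ + Σ_{s∈S} (b′(s) − λ·b(s)) = 1; and (iv) b′ = λ·b + Σ_{s∈S} (b′(s) − λ·b(s))·e_s, where e_s is the indicator (corner belief) vector of s. That is, b′ is a convex combination of b and the corner beliefs with these coefficients. (The decomposition underlying the sawtooth projection of Hauskrecht (2000) as used in Algorithm C.1.) -/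
open Finset

/-- The sawtooth decomposition (Hauskrecht 2000, Algorithm C.1): for beliefs
`b, b′` in the standard simplex with `b > 0` everywhere and
`λ = min_s b′(s)/b(s)`, one has `0 ≤ λ ≤ 1`, the coefficients
`b′(s) − λ·b(s)` are nonnegative, together with `λ` they sum to one, and `b′`
is the corresponding convex combination of `b` and the corner beliefs. -/
theorem sawtooth_decomposition
    {S : Type*} [Fintype S] [Nonempty S] [DecidableEq S]
    (b b' : S → ℝ) (hb : b ∈ stdSimplex ℝ S) (hb' : b' ∈ stdSimplex ℝ S)
    (hbpos : ∀ s, 0 < b s) :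
    let lam : ℝ := univ.inf' univ_nonempty (fun s => b' s / b s)
    (0 ≤ lam ∧ lam ≤ 1) ∧
    (∀ s, 0 ≤ b' s - lam * b s) ∧
    (lam + ∑ s, (b' s - lam * b s) = 1) ∧
    (∀ s', b' s' =
        lam * b s' + ∑ s, (b' s - lam * b s) * (if s' = s then (1 : ℝ) else 0)) := by
  intro lam
  have coeff_nonneg : ∀ s, 0 ≤ b' s - lam * b s := fun s => by
    have h : lam ≤ b' s / b s := inf'_le _ (mem_univ s)
    exact sub_nonneg.2 ((le_div_iff₀ (hbpos s)).1 h)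
  have sum_coeff : ∑ s, (b' s - lam * b s) = 1 - lam := by
    rw [sum_sub_distrib, ← mul_sum, hb.2, hb'.2, mul_one]
  refine ⟨⟨le_inf' _ _ fun s _ => div_nonneg (hb'.1 s) (hbpos s).le, ?_⟩,
    coeff_nonneg, ?_, fun s' => ?_⟩
  · exact sub_nonneg.1 (sum_coeff ▸ sum_nonneg fun s _ => coeff_nonneg s)
  · rw [sum_coeff, add_sub_cancel]
  · simp
end

section
/- Let S be a nonempty finite set and let g : (S → ℝ) → ℝ be convex on the standard simplex on S. Let b, b′ be elements of the standard simplex with b(s) > 0 for every s ∈ S, let λ = min_{s∈S} b′(s)/b(s), and suppose U_b ∈ ℝ and (U_s)_{s∈S} ⊆ ℝ satisfy g(b) ≤ U_b and g(e_s) ≤ U_s for every s. Then g(b′) ≤ λ·(U_b − Σ_{s∈S} b(s)·U_s) + Σ_{s∈S} b′(s)·U_s. (The sawtooth projection value λ(b)f(b) + Σ_s b′(s)·V̄(w_s) overestimates any convex function lying below the stored upper bounds; this is the claim that the sawtooth projection v̄(b′) overestimates the convex-hull upper bound h(b′), used in the proof of Theorem 1.) -/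
open Finset

/-- The sawtooth projection overestimates any convex function lying below the
stored upper bounds: if `g` is convex on the standard simplex, `g(b) ≤ U_b` and
`g(e_s) ≤ U_s` for the corner beliefs `e_s`, then with `λ = min_s b′(s)/b(s)`,
`g(b′) ≤ λ·(U_b − Σ_s b(s)·U_s) + Σ_s b′(s)·U_s`. -/
theorem sawtooth_overestimates_convex
    {S : Type*} [Fintype S] [Nonempty S] [DecidableEq S]
    (g : (S → ℝ) → ℝ) (hconv : ConvexOn ℝ (stdSimplex ℝ S) g)
    (b b' : S → ℝ) (hb : b ∈ stdSimplex ℝ S) (hb' : b' ∈ stdSimplex ℝ S)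
    (hbpos : ∀ s, 0 < b s)
    (Ub : ℝ) (U : S → ℝ)
    (hUb : g b ≤ Ub)
    (hU : ∀ s, g (fun s' => if s' = s then (1 : ℝ) else 0) ≤ U s) :
    g b' ≤ (univ.inf' univ_nonempty (fun s => b' s / b s)) * (Ub - ∑ s, b s * U s) +
      ∑ s, b' s * U s := by
  set l := univ.inf' univ_nonempty (fun s => b' s / b s)
  have hl0 : 0 ≤ l := (Finset.le_inf'_iff _ _).2 fun s _ => div_nonneg (hb'.1 s) (hb.1 s)
  have hl (s : S) : l * b s ≤ b' s :=
    (le_div_iff₀ (hbpos s)).1 (Finset.inf'_le (fun s => b' s / b s) (mem_univ s))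
  have hcorner (s : S) : (fun s' => if s' = s then (1 : ℝ) else 0) ∈ stdSimplex ℝ S :=
    ⟨fun s' => by dsimp only; positivity, by simp⟩
  -- Jensen's inequality for `b' = λ b + ∑ s, (b' s - λ b s) e_s`.
  have hJensen := hconv.map_sum_le (t := univ)
    (w := fun o : Option S => o.elim l fun s => b' s - l * b s)
    (p := fun o : Option S => o.elim b fun s s' => if s' = s then (1 : ℝ) else 0)
    (by
      rintro (_ | s) -
      · exact hl0
      · exact sub_nonneg.2 (hl s))
    (by simp [Fintype.sum_option, ← mul_sum, hb.2, hb'.2])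
    (by
      rintro (_ | s) -
      · exact hb
      · exact hcorner s)
  have hcomb : l • b + ∑ s, (b' s - l * b s) • (fun s' => if s' = s then (1 : ℝ) else 0) = b' := by
    ext s
    simp [Finset.sum_apply]
  simp only [Fintype.sum_option, Option.elim_none, Option.elim_some, hcomb, smul_eq_mul]
    at hJensen
  calc
    g b' ≤ _ := hJensen
    _ ≤ l * Ub + ∑ s, (b' s - l * b s) * U s := by
      gcongr with s
      · exact sub_nonneg.2 (hl s)
      · exact hU s
    _ = _ := by
      simp only [sub_mul, sum_sub_distrib, mul_assoc, ← mul_sum]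
      ring
end

section
/- Let S, A, O be nonempty finite sets, let R : S × A → ℝ be a reward function, let P : S × A × S → ℝ be nonnegative transition probabilities with Σ_{s′} P(s,a,s′) = 1 for all s,a, let Ω : A × S × O → ℝ be nonnegative observation probabilities with Σ_o Ω(a,s′,o) = 1 for all a,s′, and let Γ′ be a nonempty finite set of vectors α : S → ℝ. Define, for b in the standard simplex on S, V(b) := max_{a∈A} [ Σ_s b(s)·R(s,a) + Σ_{o∈O} max_{α∈Γ′} Σ_{s′} Ω(a,s′,o)·(Σ_s P(s,a,s′)·b(s))·α(s′) ]. Then there exists a nonempty finite set Γ of vectors α : S → ℝ such that V(b) = max_{α∈Γ} Σ_s b(s)·α(s) for every b in the standard simplex on S. (One step of the finite-horizon Bellman backup preserves the piecewise-linear-and-convex α-vector representation of the value function, Sondik's representation used in Eqns. (4)–(6).) -/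
open Finset

/-- The α-vector obtained by taking action `a` and then following the continuation vector `f o`
after each observation `o`. -/
def backupVector {S A O : Type*} [Fintype S] [Fintype O] (R : S → A → ℝ) (P : S → A → S → ℝ)
    (Ω : A → S → O → ℝ) (a : A) (f : O → S → ℝ) (s : S) : ℝ :=
  R s a + ∑ o, ∑ s', Ω a s' o * P s a s' * f o s'

theorem sum_mul_backupVector {S A O : Type*} [Fintype S] [Fintype O] (R : S → A → ℝ)
    (P : S → A → S → ℝ) (Ω : A → S → O → ℝ) (a : A) (f : O → S → ℝ) (b : S → ℝ) :
    ∑ s, b s * backupVector R P Ω a f s =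
      (∑ s, b s * R s a) + ∑ o, ∑ s', Ω a s' o * (∑ s, P s a s' * b s) * f o s' := by
  simp only [backupVector, mul_add, sum_add_distrib, mul_sum, sum_mul]
  congr 1
  rw [sum_comm]
  refine sum_congr rfl fun o _ => ?_
  rw [sum_comm]
  exact sum_congr rfl fun s' _ => sum_congr rfl fun s _ => by ring

/-- One step of the finite-horizon Bellman backup preserves the
piecewise-linear-and-convex α-vector representation (Sondik): the backed-up
value function `V` is again a maximum of finitely many linear functions of the
belief. -/
theorem bellman_backup_alpha_vector_representation
    {S A O : Type*} [Fintype S] [Nonempty S] [Fintype A] [Nonempty A]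
    [Fintype O] [Nonempty O]
    (R : S → A → ℝ)
    (P : S → A → S → ℝ) (hPnn : ∀ s a s', 0 ≤ P s a s')
    (hPsum : ∀ s a, ∑ s', P s a s' = 1)
    (Ω : A → S → O → ℝ) (hΩnn : ∀ a s' o, 0 ≤ Ω a s' o)
    (hΩsum : ∀ a s', ∑ o, Ω a s' o = 1)
    (Γ' : Finset (S → ℝ)) (hΓ' : Γ'.Nonempty) :
    ∃ (Γ : Finset (S → ℝ)) (hΓ : Γ.Nonempty),
      ∀ b ∈ stdSimplex ℝ S,
        (univ.sup' univ_nonempty (fun a : A =>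
            (∑ s, b s * R s a) +
              ∑ o, Γ'.sup' hΓ' (fun α =>
                ∑ s', Ω a s' o * (∑ s, P s a s' * b s) * α s')))
          = Γ.sup' hΓ (fun α => ∑ s, b s * α s) := by
  classical
  have : Nonempty Γ' := hΓ'.to_subtype
  refine ⟨univ.image fun p : A × (O → Γ') => backupVector R P Ω p.1 fun o => (p.2 o : S → ℝ),
    univ_nonempty.image _, fun b _ => le_antisymm ?_ ?_⟩
  · refine sup'_le _ _ fun a _ => ?_
    choose g hg hmax using fun o => exists_mem_eq_sup' hΓ' fun α : S → ℝ =>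
      ∑ s', Ω a s' o * (∑ s, P s a s' * b s) * α s'
    simp only [hmax, ← sum_mul_backupVector]
    refine le_sup' (fun α : S → ℝ => ∑ s, b s * α s) ?_
    exact mem_image.mpr ⟨(a, fun o => ⟨g o, hg o⟩), mem_univ _, rfl⟩
  · refine sup'_le _ _ fun α hα => ?_
    obtain ⟨⟨a, f⟩, -, rfl⟩ := mem_image.mp hα
    rw [sum_mul_backupVector]
    refine le_sup'_of_le _ (mem_univ a) (add_le_add_right (sum_le_sum fun o _ => ?_) _)
    exact le_sup' (fun α : S → ℝ => ∑ s', Ω a s' o * (∑ s, P s a s' * b s) * α s') (f o).2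
end

section
/- Let S, A, O be nonempty finite sets, let R : S × A → ℝ, let P : S × A × S → ℝ and Ω : A × S × O → ℝ be nonnegative, and let Γ′ be a nonempty finite set of vectors α : S → ℝ. Fix b in the standard simplex on S. For each a ∈ A and o ∈ O choose α_{a,o} ∈ Γ′ attaining max_{α∈Γ′} Σ_{s′} Ω(a,s′,o)·(Σ_s P(s,a,s′)·b(s))·α(s′), and define the backup vector g_a : S → ℝ by g_a(s) = R(s,a) + Σ_{o∈O} Σ_{s′} P(s,a,s′)·Ω(a,s′,o)·α_{a,o}(s′). Then max_{a∈A} Σ_s b(s)·g_a(s) = max_{a∈A} [ Σ_s b(s)·R(s,a) + Σ_{o∈O} max_{α∈Γ′} Σ_{s′} Ω(a,s′,o)·(Σ_s P(s,a,s′)·b(s))·α(s′) ]. (Correctness of the point-based backup operation of Eqns. (7)–(8): the α-vector returned by Backup(b,t) attains the Bellman value at b.) -/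
open Finset

/-- Correctness of the point-based backup operation (Eqns. 7–8): if for each
action `a` and observation `o` the vector `αsel a o ∈ Γ'` attains the inner
maximum at the belief `b`, then the backup vectors
`g_a(s) = R(s,a) + Σ_o Σ_{s′} P(s,a,s′)·Ω(a,s′,o)·α_{a,o}(s′)` satisfy
`max_a ⟨b, g_a⟩ = max_a [Σ_s b(s)R(s,a) + Σ_o max_{α∈Γ'} Σ_{s′} Ω·(ΣPb)·α]`. -/
theorem pointbased_backup_correct
    {S A O : Type*} [Fintype S] [Nonempty S] [Fintype A] [Nonempty A]
    [Fintype O] [Nonempty O]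
    (R : S → A → ℝ)
    (P : S → A → S → ℝ) (hPnn : ∀ s a s', 0 ≤ P s a s')
    (Ω : A → S → O → ℝ) (hΩnn : ∀ a s' o, 0 ≤ Ω a s' o)
    (Γ' : Finset (S → ℝ)) (hΓ' : Γ'.Nonempty)
    (b : S → ℝ) (hb : b ∈ stdSimplex ℝ S)
    (αsel : A → O → (S → ℝ)) (hsel : ∀ a o, αsel a o ∈ Γ')
    (hmax : ∀ a o,
      (∑ s', Ω a s' o * (∑ s, P s a s' * b s) * αsel a o s')
        = Γ'.sup' hΓ' (fun α => ∑ s', Ω a s' o * (∑ s, P s a s' * b s) * α s')) :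
    univ.sup' univ_nonempty (fun a : A =>
        ∑ s, b s * (R s a + ∑ o, ∑ s', P s a s' * Ω a s' o * αsel a o s'))
      = univ.sup' univ_nonempty (fun a : A =>
          (∑ s, b s * R s a) +
            ∑ o, Γ'.sup' hΓ' (fun α =>
              ∑ s', Ω a s' o * (∑ s, P s a s' * b s) * α s')) := by
  congr 1
  funext a
  simp_rw [← hmax, mul_add, sum_add_distrib, mul_sum]
  congr 1
  rw [sum_comm]
  refine sum_congr rfl fun o _ => ?_
  rw [sum_comm]
  refine sum_congr rfl fun s' _ => ?_
  rw [sum_mul]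
  exact sum_congr rfl fun s _ => by ring
end

section
/- Let M be a real symmetric positive semidefinite matrix indexed by {1,…,m+1}, with top-left m×m block K, cross vector k ∈ ℝᵐ (entries M(i, m+1) for i ≤ m), and bottom-right scalar κ = M(m+1, m+1). Let σ² > 0 and let T ⊆ {1,…,m} be any subset, with K_T the principal submatrix of K on T and k_T the restriction of k to T. Then κ − kᵀ·(K + σ²·I)⁻¹·k ≤ κ − k_Tᵀ·(K_T + σ²·I)⁻¹·k_T. That is, the Gaussian-process posterior variance at a test point is monotonically nonincreasing as the training set of belief points is enlarged. (The claim in Theorem 1's interpretation that σ(b) reduces as more belief points are sampled, for the posterior variance of Eqn. (11).) -/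
open Matrix

/-- The quadratic form of the inverse of a positive definite matrix dominates the one of the
compression of the matrix along any `B` for which the compression is invertible. -/
lemma Matrix.PosDef.dotProduct_compression_inv_mulVec_le {n p : Type*} [Fintype n] [DecidableEq n]
    [Fintype p] [DecidableEq p] {A : Matrix n n ℝ} (hA : A.PosDef) (B : Matrix n p ℝ)
    (hB : IsUnit (Bᵀ * A * B)) (k : n → ℝ) :
    (Bᵀ *ᵥ k) ⬝ᵥ ((Bᵀ * A * B)⁻¹ *ᵥ (Bᵀ *ᵥ k)) ≤ k ⬝ᵥ (A⁻¹ *ᵥ k) := by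
  have hdet : IsUnit A.det := (isUnit_iff_isUnit_det A).1 hA.isUnit
  have hz : A *ᵥ (A⁻¹ *ᵥ k) = k := by rw [mulVec_mulVec, mul_nonsing_inv _ hdet, one_mulVec]
  have hv : (Bᵀ * A * B) *ᵥ ((Bᵀ * A * B)⁻¹ *ᵥ (Bᵀ *ᵥ k)) = Bᵀ *ᵥ k := by
    rw [mulVec_mulVec, mul_nonsing_inv _ ((isUnit_iff_isUnit_det _).1 hB), one_mulVec]
  set z := A⁻¹ *ᵥ k
  set v := (Bᵀ * A * B)⁻¹ *ᵥ (Bᵀ *ᵥ k)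
  have hAt : Aᵀ = A := by simpa [IsHermitian] using hA.isHermitian
  have hBv : ∀ w : n → ℝ, (B *ᵥ v) ⬝ᵥ w = v ⬝ᵥ (Bᵀ *ᵥ w) := fun w => by
    rw [dotProduct_mulVec, vecMul_transpose]
  have hzy : z ⬝ᵥ (A *ᵥ (B *ᵥ v)) = k ⬝ᵥ (B *ᵥ v) := by
    rw [dotProduct_mulVec, ← mulVec_transpose, hAt, hz]
  have hyy : (B *ᵥ v) ⬝ᵥ (A *ᵥ (B *ᵥ v)) = v ⬝ᵥ (Bᵀ *ᵥ k) := by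
    rw [hBv, mulVec_mulVec, mulVec_mulVec, hv]
  have hnonneg : 0 ≤ (z - B *ᵥ v) ⬝ᵥ (A *ᵥ (z - B *ᵥ v)) := by
    simpa using hA.posSemidef.dotProduct_mulVec_nonneg (z - B *ᵥ v)
  rw [mulVec_sub, dotProduct_sub, sub_dotProduct, sub_dotProduct, hz, hzy, hyy,
    dotProduct_comm k (B *ᵥ v), hBv] at hnonneg
  rw [dotProduct_comm, dotProduct_comm k]
  linarith

/-- The quadratic form of the inverse of a positive definite matrix dominates the one of the
inverse of any principal submatrix. -/
lemma Matrix.PosDef.dotProduct_submatrix_inv_mulVec_le {n p : Type*} [Fintype n] [DecidableEq n]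
    [Fintype p] [DecidableEq p] {A : Matrix n n ℝ} (hA : A.PosDef) {e : p → n}
    (he : Function.Injective e) (k : n → ℝ) :
    (k ∘ e) ⬝ᵥ ((A.submatrix e e)⁻¹ *ᵥ (k ∘ e)) ≤ k ⬝ᵥ (A⁻¹ *ᵥ k) := by
  have hsub : ((1 : Matrix n n ℝ).submatrix id e)ᵀ * A * (1 : Matrix n n ℝ).submatrix id e =
      A.submatrix e e := by
    ext i j
    simp [Matrix.mul_apply, Matrix.one_apply]
  have hk : ((1 : Matrix n n ℝ).submatrix id e)ᵀ *ᵥ k = k ∘ e := by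
    ext i
    simp [mulVec, dotProduct, Matrix.one_apply]
  have h := hA.dotProduct_compression_inv_mulVec_le ((1 : Matrix n n ℝ).submatrix id e)
    (hsub ▸ (hA.submatrix he).isUnit) k
  rwa [hsub, hk] at h

/-- Monotonicity of the GP posterior variance (Eqn. 11) in the training set:
enlarging the set of training belief points can only decrease the posterior
variance, i.e. for any subset `T` of the indices,
`κ − kᵀ(K + σ²I)⁻¹k ≤ κ − k_Tᵀ(K_T + σ²I)⁻¹k_T`. -/
theorem gpr_posterior_variance_antitone
    (m : ℕ) (M : Matrix (Fin (m + 1)) (Fin (m + 1)) ℝ)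
    (hMsymm : M.IsSymm) (hM : M.PosSemidef) (σ2 : ℝ) (hσ2 : 0 < σ2)
    (K : Matrix (Fin m) (Fin m) ℝ) (hK : ∀ i j, K i j = M i.castSucc j.castSucc)
    (k : Fin m → ℝ) (hk : ∀ i, k i = M i.castSucc (Fin.last m))
    (κ : ℝ) (hκ : κ = M (Fin.last m) (Fin.last m))
    (T : Finset (Fin m)) :
    κ - k ⬝ᵥ (K + σ2 • (1 : Matrix (Fin m) (Fin m) ℝ))⁻¹.mulVec k ≤
      κ - (fun i : ↥T => k i.1) ⬝ᵥ
        ((K.submatrix (fun i : ↥T => i.1) (fun j : ↥T => j.1) +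
            σ2 • (1 : Matrix ↥T ↥T ℝ))⁻¹.mulVec (fun i : ↥T => k i.1)) := by
  have hKM : K = M.submatrix Fin.castSucc Fin.castSucc := by
    ext i j
    exact hK i j
  have hA : (K + σ2 • (1 : Matrix (Fin m) (Fin m) ℝ)).PosDef :=
    (Matrix.PosDef.one.smul hσ2).posSemidef_add (hKM ▸ hM.submatrix Fin.castSucc)
  have h := hA.dotProduct_submatrix_inv_mulVec_le (e := fun i : ↥T => i.1)
    Subtype.val_injective k
  rw [submatrix_add, submatrix_smul, Pi.add_apply, Pi.add_apply, Pi.smul_apply, Pi.smul_apply,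
    submatrix_one _ Subtype.val_injective] at h
  exact sub_le_sub_left h κ
end
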